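/- arXiv:2401.09201 — 2 statements merged into one kernel-verified Lean document; each statement's English description precedes it below -/
import Mathlib

section
/- For every n ≥ 1 and every n×n matrix A with real entries, the limit lim_{k→∞} (1/k)·tr(A^⊗k) exists and equals the max-plus spectral radius ρ(A) = max_{1≤p≤n} (1/p)·tr(A^⊗p), where tr(A^⊗k) is the maximum diagonal entry of the k-fold max-plus power of A. -/
open Filter

/-- Max-plus product of two real `n×n` matrices: `(A ⊗ B) i j = max_k (A i k + B k j)`. -/
noncomputable def mpMul {n : ℕ} (A B : Fin n → Fin n → ℝ) : Fin n → Fin n → ℝ :=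
  fun i j => ⨆ k : Fin n, (A i k + B k j)

/-- `p`-fold max-plus power of a real matrix, with `A^⊗1 = A`
(the value at `p = 0` is junk and is never used below). -/
noncomputable def mpPow {n : ℕ} (A : Fin n → Fin n → ℝ) : ℕ → Fin n → Fin n → ℝ
  | 0 => A
  | 1 => A
  | p + 2 => mpMul (mpPow A (p + 1)) A

/-- Norm of a real matrix: its maximum entry. -/
noncomputable def mpNorm {n : ℕ} (A : Fin n → Fin n → ℝ) : ℝ :=
  ⨆ i : Fin n, ⨆ j : Fin n, A i j

/-- Max-plus trace of a real matrix: its maximum diagonal entry. -/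
noncomputable def mpTr {n : ℕ} (A : Fin n → Fin n → ℝ) : ℝ :=
  ⨆ i : Fin n, A i i

/-- Max-plus spectral radius: `ρ(A) = max_{1 ≤ p ≤ n} (1/p)·tr(A^⊗p)`. -/
noncomputable def mpRho {n : ℕ} (A : Fin n → Fin n → ℝ) : ℝ :=
  ⨆ p : Fin n, (((p : ℕ) + 1 : ℝ))⁻¹ * mpTr (mpPow A ((p : ℕ) + 1))

theorem mpPow_succ {n : ℕ} (A : Fin n → Fin n → ℝ) {k : ℕ} (hk : 1 ≤ k) :
    mpPow A (k + 1) = mpMul (mpPow A k) A := by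
  obtain ⟨k, rfl⟩ := Nat.exists_eq_add_of_le' hk
  rfl

theorem add_le_mpMul {n : ℕ} (A B : Fin n → Fin n → ℝ) (i m j : Fin n) :
    A i m + B m j ≤ mpMul A B i j :=
  le_ciSup (f := fun m => A i m + B m j) (Set.finite_range _).bddAbove m

theorem exists_mpMul_eq {n : ℕ} (A B : Fin n → Fin n → ℝ) (i j : Fin n) :
    ∃ m, A i m + B m j = mpMul A B i j :=
  have : Nonempty (Fin n) := ⟨i⟩
  exists_eq_ciSup_of_finite (f := fun m => A i m + B m j)

theorem le_mpTr {n : ℕ} (A : Fin n → Fin n → ℝ) (i : Fin n) : A i i ≤ mpTr A :=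
  le_ciSup (f := fun i => A i i) (Set.finite_range _).bddAbove i

/-- Max-plus powers are superadditive along concatenation of walks. -/
theorem mpPow_add_le {n : ℕ} (A : Fin n → Fin n → ℝ) {a b : ℕ} (ha : 1 ≤ a) (hb : 1 ≤ b)
    (i m j : Fin n) : mpPow A a i m + mpPow A b m j ≤ mpPow A (a + b) i j := by
  induction b, hb using Nat.le_induction generalizing j with
  | base =>
    rw [mpPow_succ A ha]
    exact add_le_mpMul (mpPow A a) A i m j
  | succ b hb ih =>
    rw [← add_assoc, mpPow_succ A hb, mpPow_succ A (k := a + b) (by omega)]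
    obtain ⟨l, hl⟩ := exists_mpMul_eq (mpPow A b) A m j
    have h := add_le_mpMul (mpPow A (a + b)) A i l j
    linarith [ih l]

/-- The weight of a walk of length `k` is at most the corresponding entry of `A^⊗k`. -/
theorem sum_walk_le_mpPow {n : ℕ} (A : Fin n → Fin n → ℝ) {k : ℕ} (hk : 1 ≤ k)
    (v : ℕ → Fin n) :
    ∑ t ∈ Finset.range k, A (v t) (v (t + 1)) ≤ mpPow A k (v 0) (v k) := by
  induction k, hk using Nat.le_induction with
  | base => simp [mpPow]
  | succ k hk ih =>
    rw [Finset.sum_range_succ, mpPow_succ A hk]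
    have h := add_le_mpMul (mpPow A k) A (v 0) (v k) (v (k + 1))
    linarith

/-- Every entry of `A^⊗k` is the weight of some walk of length `k`. -/
theorem exists_walk_eq_mpPow {n : ℕ} (A : Fin n → Fin n → ℝ) {k : ℕ} (hk : 1 ≤ k)
    (i j : Fin n) :
    ∃ v : ℕ → Fin n, v 0 = i ∧ v k = j ∧
      ∑ t ∈ Finset.range k, A (v t) (v (t + 1)) = mpPow A k i j := by
  induction k, hk using Nat.le_induction generalizing j with
  | base => exact ⟨fun t => if t = 0 then i else j, by simp, by simp, by simp [mpPow]⟩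
  | succ k hk ih =>
    obtain ⟨l, hl⟩ := exists_mpMul_eq (mpPow A k) A i j
    obtain ⟨v, h0, h1, h2⟩ := ih l
    refine ⟨fun t => if t ≤ k then v t else j, by simp [h0], by simp, ?_⟩
    rw [Finset.sum_range_succ, mpPow_succ A hk, ← hl, ← h2]
    congr 1
    · refine Finset.sum_congr rfl fun t ht => ?_
      have ht := Finset.mem_range.1 ht
      simp [ht.le, Nat.succ_le_of_lt ht]
    · simp [h1]

theorem mpTr_mpPow_le_of_le {n : ℕ} (A : Fin n → Fin n → ℝ) {k : ℕ} (hk : 1 ≤ k)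
    (hkn : k ≤ n) : mpTr (mpPow A k) ≤ k * mpRho A := by
  obtain ⟨p, rfl⟩ := Nat.exists_eq_add_of_le' hk
  have h : ((p : ℝ) + 1)⁻¹ * mpTr (mpPow A (p + 1)) ≤ mpRho A :=
    le_ciSup (f := fun p : Fin n => (((p : ℕ) + 1 : ℝ))⁻¹ * mpTr (mpPow A ((p : ℕ) + 1)))
      (Set.finite_range _).bddAbove ⟨p, hkn⟩
  rw [inv_mul_le_iff₀ (by positivity)] at h
  exact_mod_cast h

/-- The mean weight of a closed walk is at most the max-plus spectral radius. -/
theorem sum_closed_walk_le {n : ℕ} (A : Fin n → Fin n → ℝ) (k : ℕ) (hk : 1 ≤ k)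
    (v : ℕ → Fin n) (hv : v 0 = v k) :
    ∑ t ∈ Finset.range k, A (v t) (v (t + 1)) ≤ k * mpRho A := by
  induction k using Nat.strong_induction_on generalizing v with
  | _ k ih =>
  rcases le_or_gt k n with hkn | hkn
  · have h := sum_walk_le_mpPow A hk v
    rw [← hv] at h
    exact h.trans ((le_mpTr _ _).trans (mpTr_mpPow_le_of_le A hk hkn))
  · obtain ⟨s, d, e, hd, he, hdk, rfl, hsd⟩ :
        ∃ s d e, 1 ≤ d ∧ 1 ≤ e ∧ d ≤ n ∧ k = s + d + e ∧ v s = v (s + d) := by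
      obtain ⟨x, y, hxy, h⟩ := Fintype.exists_ne_map_eq_of_card_lt
        (fun x : Fin (n + 1) => v x) (by simp)
      have hne : (x : ℕ) ≠ y := fun h => hxy (Fin.ext h)
      rcases lt_or_gt_of_ne hne with hlt | hlt
      · refine ⟨x, y - x, k - y, by omega, by omega, by omega, by omega, ?_⟩
        rw [Nat.add_sub_cancel' hlt.le]
        exact h
      · refine ⟨y, x - y, k - x, by omega, by omega, by omega, by omega, ?_⟩
        rw [Nat.add_sub_cancel' hlt.le]
        exact h.symm
    have h1 := ih d (by omega) hd (fun t => v (s + t)) (by simpa using hsd)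
    have h2 := ih (s + e) (by omega) (by omega)
      (fun t => if t ≤ s then v t else v (t + d))
      (by
        have h : ¬ s + e ≤ s := by omega
        simp only [h, Nat.zero_le, if_true, if_false]
        rw [hv, add_right_comm])
    have h3 : ∀ t, (if s + t ≤ s then v (s + t) else v (s + t + d)) = v (s + d + t) := by
      intro t
      rcases Nat.eq_zero_or_pos t with rfl | ht
      · simpa using hsd
      · rw [if_neg (by omega), add_right_comm]
    have h4 : ∑ t ∈ Finset.range s, A (if t ≤ s then v t else v (t + d))
          (if t + 1 ≤ s then v (t + 1) else v (t + 1 + d)) =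
        ∑ t ∈ Finset.range s, A (v t) (v (t + 1)) := by
      refine Finset.sum_congr rfl fun t ht => ?_
      have ht := Finset.mem_range.1 ht
      rw [if_pos ht.le, if_pos (Nat.succ_le_of_lt ht)]
    simp only [Finset.sum_range_add, h4, add_assoc s _ 1] at h2
    simp only [h3] at h2
    rw [Finset.sum_range_add, Finset.sum_range_add]
    push_cast at h2 ⊢
    simp only [← add_assoc] at h1 h2 ⊢
    linarith

theorem mpPow_diag_le {n : ℕ} (A : Fin n → Fin n → ℝ) {k : ℕ} (hk : 1 ≤ k) (i : Fin n) :
    mpPow A k i i ≤ k * mpRho A := by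
  obtain ⟨v, h0, h1, h2⟩ := exists_walk_eq_mpPow A hk i i
  rw [← h2]
  exact sum_closed_walk_le A k hk v (h0.trans h1.symm)

/-- Some diagonal entry of some power attains the max-plus spectral radius. -/
theorem exists_mpPow_diag_eq {n : ℕ} (hn : 1 ≤ n) (A : Fin n → Fin n → ℝ) :
    ∃ p : ℕ, 1 ≤ p ∧ ∃ i, mpPow A p i i = p * mpRho A := by
  have : Nonempty (Fin n) := ⟨⟨0, hn⟩⟩
  obtain ⟨p, hp⟩ := exists_eq_ciSup_of_finite
    (f := fun p : Fin n => (((p : ℕ) + 1 : ℝ))⁻¹ * mpTr (mpPow A ((p : ℕ) + 1)))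
  obtain ⟨i, hi⟩ := exists_eq_ciSup_of_finite (f := fun i => mpPow A ((p : ℕ) + 1) i i)
  refine ⟨p + 1, by omega, i, hi.trans ?_⟩
  change mpTr _ = _
  rw [mpRho, ← hp]
  push_cast
  field_simp

/-- For every `n ≥ 1` and every real `n×n` matrix `A`, the limit
`lim_{k→∞} (1/k)·tr(A^⊗k)` exists and equals the max-plus spectral radius `ρ(A)`. -/
theorem stmt_2 {n : ℕ} (hn : 1 ≤ n) (A : Fin n → Fin n → ℝ) :
    Tendsto (fun k : ℕ => (k : ℝ)⁻¹ * mpTr (mpPow A k)) atTop (nhds (mpRho A)) := by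
  have : Nonempty (Fin n) := ⟨⟨0, hn⟩⟩
  obtain ⟨p, hp, i, hpi⟩ := exists_mpPow_diag_eq hn A
  set u : ℕ → ℝ := fun k => if k = 0 then 0 else -mpPow A k i i with hu
  have hu_pos : ∀ k, 1 ≤ k → u k = -mpPow A k i i := fun k hk => if_neg (by omega)
  have hsub : Subadditive u := by
    intro a b
    rcases Nat.eq_zero_or_pos a with rfl | ha
    · simp [hu]
    rcases Nat.eq_zero_or_pos b with rfl | hb
    · simp [hu]
    rw [hu_pos _ ha, hu_pos _ hb, hu_pos _ (by omega)]
    linarith [mpPow_add_le A ha hb i i i]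
  have hle : ∀ k, 1 ≤ k → -mpRho A ≤ u k / k := by
    intro k hk
    have hk' : (0 : ℝ) < k := by exact_mod_cast hk
    rw [hu_pos k hk, le_div_iff₀ hk']
    linarith [mpPow_diag_le A hk i]
  have hbdd : BddBelow (Set.range fun k => u k / k) := by
    refine ⟨min 0 (-mpRho A), ?_⟩
    rintro _ ⟨k, rfl⟩
    rcases Nat.eq_zero_or_pos k with rfl | hk
    · simp
    · exact (min_le_right _ _).trans (hle k hk)
  have hlim : hsub.lim = -mpRho A := by
    apply le_antisymm
    · have h := hsub.lim_le_div hbdd (n := p) (by omega)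
      have hp' : (p : ℝ) ≠ 0 := by exact_mod_cast (by omega : p ≠ 0)
      rwa [hu_pos p hp, hpi, neg_div, mul_div_cancel_left₀ _ hp'] at h
    · exact ge_of_tendsto (hsub.tendsto_lim hbdd) (eventually_atTop.2 ⟨1, hle⟩)
  have hconv := (hsub.tendsto_lim hbdd).neg
  rw [hlim, neg_neg] at hconv
  refine tendsto_of_tendsto_of_tendsto_of_le_of_le' hconv tendsto_const_nhds ?_ ?_
  · filter_upwards [eventually_ge_atTop 1] with k hk
    rw [hu_pos k hk, neg_div, neg_neg, div_eq_inv_mul]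
    exact mul_le_mul_of_nonneg_left (le_mpTr _ i) (by positivity)
  · filter_upwards [eventually_ge_atTop 1] with k hk
    have hk' : (0 : ℝ) < k := by exact_mod_cast hk
    rw [inv_mul_le_iff₀ hk']
    exact ciSup_le fun j => mpPow_diag_le A hk j
end

section
/- Let n ≥ 1 and let A be an n×n matrix with real entries (no entries equal to -∞). Then for every integer k ≥ 1, the maximum entry of the k-fold max-plus power of A satisfies ‖A^⊗k‖ ≤ k·ρ(A) + ‖A ⊗ A^-‖, where A^- is the multiplicative conjugate matrix with entries (A^-)_{ij} = -A_{ji}, so that ‖A ⊗ A^-‖ = max_{i,j} max_l (A_{il} - A_{jl}). -/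
open Filter

/-- Multiplicative conjugate of a real matrix: `(A^-) i j = -(A j i)`. -/
def mpConj {n : ℕ} (A : Fin n → Fin n → ℝ) : Fin n → Fin n → ℝ :=
  fun i j => -(A j i)

/-- Weight of the first `L` steps of the walk `v` in the complete digraph weighted by `A`. -/
def walkWeight {n : ℕ} (A : Fin n → Fin n → ℝ) (v : ℕ → Fin n) (L : ℕ) : ℝ :=
  ∑ t ∈ Finset.range L, A (v t) (v (t + 1))

theorem walkWeight_le_mpPow {n : ℕ} (A : Fin n → Fin n → ℝ) (v : ℕ → Fin n) (p : ℕ) :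
    walkWeight A v (p + 1) ≤ mpPow A (p + 1) (v 0) (v (p + 1)) := by
  induction p with
  | zero => simp [walkWeight, mpPow]
  | succ p ih =>
    rw [walkWeight, Finset.sum_range_succ]
    exact (add_le_add_left ih _).trans
      (le_ciSup (f := fun k => mpPow A (p + 1) (v 0) k + A k (v (p + 2)))
        (Set.finite_range _).bddAbove (v (p + 1)))

theorem exists_walkWeight_eq_mpPow {n : ℕ} (A : Fin n → Fin n → ℝ) (i j : Fin n) (p : ℕ) :
    ∃ v : ℕ → Fin n, v 0 = i ∧ v (p + 1) = j ∧ mpPow A (p + 1) i j = walkWeight A v (p + 1) := by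
  induction p generalizing j with
  | zero => exact ⟨fun t => if t = 0 then i else j, by simp [walkWeight, mpPow]⟩
  | succ p ih =>
    have : Nonempty (Fin n) := ⟨i⟩
    obtain ⟨k, hk⟩ := exists_eq_ciSup_of_finite (f := fun k => mpPow A (p + 1) i k + A k j)
    obtain ⟨v, h0, hp, hv⟩ := ih k
    refine ⟨fun t => if t ≤ p + 1 then v t else j, by simpa using h0, by simp, ?_⟩
    change (⨆ k, (mpPow A (p + 1) i k + A k j)) = _
    rw [← hk, walkWeight, Finset.sum_range_succ, hv, walkWeight]
    congr 1
    · refine Finset.sum_congr rfl fun t ht => ?_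
      have ht := Finset.mem_range.1 ht
      rw [if_pos (by omega), if_pos (by omega)]
    · simp [hp]

/-- A cycle between times `s` and `s + d` can be cut out of a walk. -/
theorem walkWeight_eq_add_of_eq {n : ℕ} (A : Fin n → Fin n → ℝ) (v : ℕ → Fin n) (s d r : ℕ)
    (h : v s = v (s + d)) :
    walkWeight A v (s + d + r) = walkWeight A (fun t => v (s + t)) d +
      walkWeight A (fun t => if t ≤ s then v t else v (t + d)) (s + r) := by
  simp only [walkWeight]
  rw [Finset.sum_range_add, Finset.sum_range_add, Finset.sum_range_add (n := s) (m := r)]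
  have h₁ : ∑ t ∈ Finset.range s, A (if t ≤ s then v t else v (t + d))
      (if t + 1 ≤ s then v (t + 1) else v (t + 1 + d)) =
      ∑ t ∈ Finset.range s, A (v t) (v (t + 1)) := by
    refine Finset.sum_congr rfl fun t ht => ?_
    have ht := Finset.mem_range.1 ht
    rw [if_pos (by omega), if_pos (by omega)]
  have h₂ : ∑ t ∈ Finset.range r, A (if s + t ≤ s then v (s + t) else v (s + t + d))
      (if s + t + 1 ≤ s then v (s + t + 1) else v (s + t + 1 + d)) =
      ∑ t ∈ Finset.range r, A (v (s + d + t)) (v (s + d + t + 1)) := by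
    refine Finset.sum_congr rfl fun t _ => ?_
    rw [if_neg (by omega : ¬ s + t + 1 ≤ s), add_right_comm s d t, add_right_comm (s + t) d 1]
    split_ifs with ht
    · obtain rfl : t = 0 := by omega
      simp [h]
    · rfl
  rw [h₁, h₂]
  simp only [add_assoc]
  ring

theorem mpTr_mpPow_le {n : ℕ} (A : Fin n → Fin n → ℝ) {p : ℕ} (hp : p < n) :
    mpTr (mpPow A (p + 1)) ≤ ((p + 1 : ℕ) : ℝ) * mpRho A := by
  have h := le_ciSup (f := fun q : Fin n => (((q : ℕ) + 1 : ℝ))⁻¹ * mpTr (mpPow A ((q : ℕ) + 1)))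
    (Set.finite_range _).bddAbove ⟨p, hp⟩
  rw [inv_mul_le_iff₀ (by positivity)] at h
  push_cast
  exact h

/-- The mean weight of a closed walk is at most the spectral radius. -/
theorem walkWeight_le_mul_mpRho {n : ℕ} (A : Fin n → Fin n → ℝ) (L : ℕ) (v : ℕ → Fin n)
    (h : v 0 = v L) : walkWeight A v L ≤ L * mpRho A := by
  induction L using Nat.strong_induction_on generalizing v with
  | _ L ih =>
    rcases L with _ | p
    · simp [walkWeight]
    by_cases hp : p < n
    · refine (walkWeight_le_mpPow A v p).trans (le_trans ?_ (mpTr_mpPow_le A hp))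
      rw [← h]
      exact le_ciSup (f := fun i => mpPow A (p + 1) i i) (Set.finite_range _).bddAbove (v 0)
    · obtain ⟨s, t, hst, ht, hv⟩ : ∃ s t, s < t ∧ t < p + 1 ∧ v s = v t := by
        obtain ⟨x, y, hxy, hv⟩ := Fintype.exists_ne_map_eq_of_card_lt
          (fun x : Fin (p + 1) => v x) (by simp; omega)
        rcases lt_or_gt_of_ne hxy with hlt | hlt
        · exact ⟨x, y, hlt, y.2, hv⟩
        · exact ⟨y, x, hlt, x.2, hv.symm⟩
      obtain ⟨d, rfl⟩ := Nat.exists_eq_add_of_lt hst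
      obtain ⟨r, hr⟩ := Nat.exists_eq_add_of_lt ht
      have hL : p + 1 = s + (d + 1) + (r + 1) := by omega
      rw [hL] at ih h ⊢
      rw [walkWeight_eq_add_of_eq A v s (d + 1) (r + 1) hv]
      have h₁ := ih (d + 1) (by omega) (fun t => v (s + t)) hv
      have h₂ := ih (s + (r + 1)) (by omega)
        (fun t => if t ≤ s then v t else v (t + (d + 1))) (by
          simpa [add_right_comm s (r + 1) (d + 1)] using h)
      push_cast at h₁ h₂ ⊢
      linarith

theorem sub_le_mpNorm_mpMul_mpConj {n : ℕ} (A : Fin n → Fin n → ℝ) (i j l : Fin n) :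
    A i l - A j l ≤ mpNorm (mpMul A (mpConj A)) := by
  calc A i l - A j l = A i l + mpConj A l j := sub_eq_add_neg _ _
    _ ≤ mpMul A (mpConj A) i j :=
      le_ciSup (f := fun k => A i k + mpConj A k j) (Set.finite_range _).bddAbove l
    _ ≤ ⨆ j, mpMul A (mpConj A) i j := le_ciSup (Set.finite_range _).bddAbove j
    _ ≤ mpNorm (mpMul A (mpConj A)) :=
      le_ciSup (f := fun i => ⨆ j, mpMul A (mpConj A) i j) (Set.finite_range _).bddAbove i

/-- For every `n ≥ 1`, every real `n×n` matrix `A` (no `-∞` entries), and every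
integer `k ≥ 1`, the maximum entry of the `k`-fold max-plus power of `A` satisfies
`‖A^⊗k‖ ≤ k·ρ(A) + ‖A ⊗ A^-‖`, where `‖A ⊗ A^-‖ = max_{i,j} max_l (A i l - A j l)`. -/
theorem stmt_3 {n : ℕ} (hn : 1 ≤ n) (A : Fin n → Fin n → ℝ) (k : ℕ) (hk : 1 ≤ k) :
    mpNorm (mpPow A k) ≤ (k : ℝ) * mpRho A + mpNorm (mpMul A (mpConj A)) := by
  obtain ⟨p, rfl⟩ := Nat.exists_eq_add_of_le' hk
  have : Nonempty (Fin n) := ⟨⟨0, hn⟩⟩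
  refine ciSup_le fun i => ciSup_le fun j => ?_
  obtain ⟨v, -, hj, hv⟩ := exists_walkWeight_eq_mpPow A i j p
  have hclosed := walkWeight_le_mul_mpRho A (p + 1) (Function.update v 0 j) (by simp [hj])
  have hstep := sub_le_mpNorm_mpMul_mpConj A (v 0) j (v 1)
  rw [hv]
  simp only [walkWeight, Finset.sum_range_succ'] at hclosed ⊢
  simp at hclosed ⊢
  linarith
end
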